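/- If M is a countable recursively saturated structure in a recursive language, then M is resplendent. -/

import Mathlib

/- STATEMENT 2: If M is a countable recursively saturated structure in a recursive language, then M is resplendent (Barwise–Schlipf/Ressayre). -/

open FirstOrder FirstOrder.Language

universe u

/-- Recursive saturation: every recursive type over `M` is realized in `M`. -/
def IsRecursivelySaturated (L : FirstOrder.Language.{u, u}) (M : Type u) [L.Structure M]
    [∀ n, Encodable (L.Functions n)] [∀ n, Encodable (L.Relations n)] : Prop :=
  ∀ (k : ℕ) (φ : ℕ → L.Formula (Fin k ⊕ Fin 1)) (a : Fin k → M),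
    Computable (fun n => Encodable.encode (φ n).listEncode) →
    (∀ s : Finset ℕ, ∃ x : M, ∀ n ∈ s, (φ n).Realize (Sum.elim a fun _ => x)) →
    ∃ x : M, ∀ n, (φ n).Realize (Sum.elim a fun _ => x)

/-- The language with a single relation symbol of arity `r` (the set variable `X`). -/
def relLang (r : ℕ) : FirstOrder.Language.{u, u} :=
  ⟨fun _ => PEmpty, fun n => ULift (PLift (n = r))⟩

/-- `M` is resplendent if for every Σ¹₁ sentence `Φ = ∃X φ(X)` in the language of `M`
expanded by names for all elements of `M` (here rendered as a sentence `φ` of the language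
with one extra relation symbol `X` of some arity `r`), if `ElDiag(M) ∪ {φ}` is consistent
then `M ⊨ ∃X φ(X)`, i.e. some interpretation of `X` on `M` makes `φ` true. -/
def IsResplendent (L : FirstOrder.Language.{u, u}) (M : Type u) [L.Structure M] : Prop :=
  ∀ (r : ℕ) (Φ : ((L[[M]]).sum (relLang.{u} r)).Sentence),
    Theory.IsSatisfiable
      ((LHom.sumInl : L[[M]] →ᴸ (L[[M]]).sum (relLang.{u} r)).onTheory (L.elementaryDiagram M)
        ∪ {Φ}) →
    ∃ S : (relLang.{u} r).Structure M,
      @Sentence.Realize _ M (@Language.sumStructure (L[[M]]) (relLang.{u} r) M _ S) Φ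

namespace FirstOrder.Language

open Encodable

section Codes

variable {L : FirstOrder.Language.{u, u}} [∀ n, Encodable (L.Functions n)]

/-- The sequence of codes of the symbols of a term. -/
def Term.codes {α : Type*} [Encodable α] (t : L.Term α) : List ℕ := t.listEncode.map encode

theorem encode_list_eq_encode_map {α : Type*} [Encodable α] (l : List α) :
    encode l = encode (l.map encode) := by
  induction l with
  | nil => rfl
  | cons a l ih => simp only [List.map_cons, encode_list_cons, ih, encode_nat]

theorem Term.encode_eq_encode_codes {α : Type*} [Encodable α] (t : L.Term α) :
    encode t = encode t.codes :=
  encode_list_eq_encode_map t.listEncode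

theorem Primrec.flatMap_const {σ ι β : Type*} [Primcodable σ] [Primcodable β] (l : List ι)
    {f : σ → ι → List β} (hf : ∀ i, Primrec fun s => f s i) :
    Primrec fun s => l.flatMap (f s) := by
  induction l with
  | nil => exact Primrec.const []
  | cons i l ih => exact Primrec.list_append.comp (hf i) ih

theorem Primrec.encode_inl {σ : Type*} {α β : σ → Type*} [Primcodable σ] [∀ s, Encodable (α s)]
    [∀ s, Encodable (β s)] {f : ∀ s, α s} (hf : Primrec fun s => encode (f s)) :
    Primrec fun s => encode (Sum.inl (f s) : α s ⊕ β s) :=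
  Primrec.nat_mul.comp (Primrec.const 2) hf

theorem Primrec.encode_inr {σ : Type*} {α β : σ → Type*} [Primcodable σ] [∀ s, Encodable (α s)]
    [∀ s, Encodable (β s)] {f : ∀ s, β s} (hf : Primrec fun s => encode (f s)) :
    Primrec fun s => encode (Sum.inr (f s) : α s ⊕ β s) :=
  Primrec.succ.comp (Primrec.nat_mul.comp (Primrec.const 2) hf)

theorem Term.primrec_codes_relabel {σ γ : Type*} {δ : σ → Type*} [Primcodable σ]
    [∀ s, Encodable (δ s)] (t : L.Term γ) {g : ∀ s, γ → δ s}
    (hg : ∀ x, Primrec fun s => encode (g s x)) :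
    Primrec fun s => (t.relabel (g s)).codes := by
  induction t with
  | var x =>
    exact Primrec.list_cons.comp (Primrec.encode_inl (β := fun _ => Σ i, L.Functions i) (hg x))
      (Primrec.const [])
  | @func n f ts ih =>
    have h : ∀ s, ((Term.func f ts).relabel (g s)).codes =
        encode (Sum.inr ⟨n, f⟩ : δ s ⊕ Σ i, L.Functions i) ::
          (List.finRange n).flatMap fun i => ((ts i).relabel (g s)).codes := fun s => by
      simp only [Term.codes, Term.relabel, Term.listEncode, List.map_cons, List.map_flatMap]
    simp only [h]
    exact Primrec.list_cons.comp (Primrec.encode_inr (Primrec.const _))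
      (Primrec.flatMap_const _ ih)

theorem Primrec.encode_relabelAux {σ α β : Type*} [Primcodable σ] [Encodable α] {m : σ → ℕ}
    (hm : Primrec m) {g : ∀ s, β → α ⊕ Fin (m s)} (hg : ∀ b, Primrec fun s => encode (g s b))
    (j : ℕ) (x : β ⊕ Fin j) :
    Primrec fun s => encode (BoundedFormula.relabelAux (g s) j x) := by
  rcases x with b | i
  · refine (hg b).of_eq fun s => ?_
    simp only [BoundedFormula.relabelAux, Function.comp_apply, Sum.map_inl]
    rcases g s b with a | i <;> rfl
  · exact Primrec.encode_inr (α := fun _ => α) (β := fun s => Fin (m s + j))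
      (f := fun s => Fin.natAdd (m s) i) (Primrec.nat_add.comp hm (Primrec.const (i : ℕ)))

variable [∀ n, Encodable (L.Relations n)]

/-- The sequence of codes of the symbols of a formula. -/
def BoundedFormula.codes {α : Type*} [Encodable α] {n : ℕ} (φ : L.BoundedFormula α n) : List ℕ :=
  φ.listEncode.map encode

/-- The code of a term occurring in a formula, tagged with the number of bound variables. -/
theorem Primrec.encode_sigma_term {σ α γ : Type*} [Primcodable σ] [Encodable α] {m : σ → ℕ}
    (hm : Primrec m) (t : L.Term γ) {g : ∀ s, γ → α ⊕ Fin (m s)}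
    (hg : ∀ x, Primrec fun s => encode (g s x)) :
    Primrec fun s => encode (Sum.inl ⟨m s, t.relabel (g s)⟩ :
      (Σ k, L.Term (α ⊕ Fin k)) ⊕ ((Σ n, L.Relations n) ⊕ ℕ)) := by
  refine Primrec.encode_inl (α := fun _ => Σ k, L.Term (α ⊕ Fin k)) (β := fun _ => _)
    (f := fun s => ⟨m s, t.relabel (g s)⟩) ?_
  simp only [encode_sigma_val, Term.encode_eq_encode_codes, encode_nat]
  exact Primrec₂.natPair.comp hm (Primrec.encode.comp (t.primrec_codes_relabel hg))

namespace BoundedFormula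

theorem codes_falsum {α : Type*} [Encodable α] (n : ℕ) :
    (falsum : L.BoundedFormula α n).codes = [2 * (2 * (n + 2) + 1) + 1] := rfl

theorem codes_imp {α : Type*} [Encodable α] {n : ℕ} (φ ψ : L.BoundedFormula α n) :
    (φ.imp ψ).codes = 3 :: (φ.codes ++ ψ.codes) := by
  simp only [codes, listEncode, List.map_cons, List.map_append, List.cons_append]
  rfl

theorem codes_all {α : Type*} [Encodable α] {n : ℕ} (φ : L.BoundedFormula α (n + 1)) :
    φ.all.codes = 7 :: φ.codes := rfl

theorem primrec_codes_falsum {σ : Type*} [Primcodable σ] (α : Type*) [Encodable α] {m : σ → ℕ}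
    (hm : Primrec m) : Primrec fun s => (falsum : L.BoundedFormula α (m s)).codes := by
  simp only [codes_falsum]
  exact Primrec.list_cons.comp (Primrec.succ.comp (Primrec.nat_mul.comp (Primrec.const 2)
    (Primrec.succ.comp (Primrec.nat_mul.comp (Primrec.const 2)
      (Primrec.nat_add.comp hm (Primrec.const 2)))))) (Primrec.const [])

theorem primrec_codes_relabel {σ α β : Type*} [Primcodable σ] [Encodable α] {j : ℕ}
    (φ : L.BoundedFormula β j) {m : σ → ℕ} (hm : Primrec m) {g : ∀ s, β → α ⊕ Fin (m s)}
    (hg : ∀ b, Primrec fun s => encode (g s b)) :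
    Primrec fun s => (φ.relabel (g s)).codes := by
  induction φ with
  | @falsum j =>
    simp only [relabel_falsum]
    exact primrec_codes_falsum α (Primrec.nat_add.comp hm (Primrec.const j))
  | @equal j t₁ t₂ =>
    have hm' : Primrec fun s => m s + j := Primrec.nat_add.comp hm (Primrec.const j)
    exact Primrec.list_cons.comp
      (Primrec.encode_sigma_term hm' t₁ (Primrec.encode_relabelAux hm hg j))
      (Primrec.list_cons.comp
        (Primrec.encode_sigma_term hm' t₂ (Primrec.encode_relabelAux hm hg j)) (Primrec.const []))
  | @rel j l R ts =>
    have hm' : Primrec fun s => m s + j := Primrec.nat_add.comp hm (Primrec.const j)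
    have h : ∀ s, ((rel R ts).relabel (g s)).codes =
        encode (Sum.inr (Sum.inl ⟨l, R⟩) :
          (Σ k, L.Term (α ⊕ Fin k)) ⊕ ((Σ n, L.Relations n) ⊕ ℕ)) ::
        encode (Sum.inr (Sum.inr (m s + j)) :
          (Σ k, L.Term (α ⊕ Fin k)) ⊕ ((Σ n, L.Relations n) ⊕ ℕ)) ::
        (List.finRange l).flatMap fun i => [encode (Sum.inl ⟨m s + j,
          (ts i).relabel (relabelAux (g s) j)⟩ :
            (Σ k, L.Term (α ⊕ Fin k)) ⊕ ((Σ n, L.Relations n) ⊕ ℕ))] := fun s => by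
      simp only [codes, relabel, mapTermRel, listEncode, List.map_cons,
        List.map_map, List.cons_append, List.nil_append, id]
      rw [← List.map_eq_flatMap]
      rfl
    simp only [h]
    refine Primrec.list_cons.comp (Primrec.const _) (Primrec.list_cons.comp
      (Primrec.encode_inr (α := fun _ => _) (β := fun _ => _)
        (Primrec.encode_inr (α := fun _ => _) (β := fun _ => ℕ) hm'))
      (Primrec.flatMap_const _ fun i => Primrec.list_cons.comp
        (Primrec.encode_sigma_term hm' (ts i) (Primrec.encode_relabelAux hm hg j))
        (Primrec.const [])))
  | imp φ ψ ih₁ ih₂ =>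
    simp only [relabel_imp, codes_imp]
    exact Primrec.list_cons.comp (Primrec.const 3) (Primrec.list_append.comp ih₁ ih₂)
  | all φ ih =>
    simp only [relabel_all, codes_all]
    exact Primrec.list_cons.comp (Primrec.const 7) ih

end BoundedFormula

end Codes

/-! ### Approximations to a closed game -/

section Approximations

variable {L : FirstOrder.Language.{u, u}} {β : Type*} (C : L.Formula β) (g : β → ℕ → ℕ)
  (B : ℕ → ℕ)

/-- The variable standing for position `p` in a formula about `k` parameters (positions below `k`),
one distinguished variable (position `k`) and `m` bound variables (positions above `k`). -/
def posVar (k m p : ℕ) : (Fin k ⊕ Fin 1) ⊕ Fin m :=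
  if h : p < k then .inl (.inl ⟨p, h⟩)
  else if h : k < p ∧ p - (k + 1) < m then .inr ⟨p - (k + 1), h.2⟩
  else .inl (.inr 0)

/-- Player `∃` can keep all instances of `C` on the first `k + d` positions true when positions
`k, …, k + d - 1` are still to be played, the even ones by `∀` and the odd ones by `∃`.
The `t`-th instance of `C` looks at the positions `g b t`, all of them at most `B t`. -/
def Survives {K : Type*} [L.Structure K] : ℕ → ℕ → (ℕ → K) → Prop
  | 0, k, s => ∀ t < k, B t < k → C.Realize fun b => s (g b t)
  | d + 1, k, s =>
    if Even k then ∀ y, Survives d (k + 1) (Function.update s k y)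
    else ∃ y, Survives d (k + 1) (Function.update s k y)

/-- The conjunction of all instances of `C` on the first `k + 1 + j` positions. -/
noncomputable def instances (k j : ℕ) : L.BoundedFormula (Fin k ⊕ Fin 1) j :=
  (((List.range (k + 1 + j)).map fun t =>
    if B t < k + 1 + j then
      (BoundedFormula.relabel (fun b => posVar k j (g b t)) C : L.BoundedFormula _ (j + 0))
    else BoundedFormula.not ⊥).foldr BoundedFormula.imp ⊥).not

/-- The formula expressing `Survives d (k + 1 + j)`. -/
noncomputable def approx (k : ℕ) : ∀ _d j : ℕ, L.BoundedFormula (Fin k ⊕ Fin 1) j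
  | 0, j => instances C g B k j
  | d + 1, j => if Even (k + 1 + j) then (approx k d (j + 1)).all else (approx k d (j + 1)).ex

theorem elim_posVar_snoc {K : Type*} {k j : ℕ} {v : Fin k ⊕ Fin 1 → K} {xs : Fin j → K}
    {s : ℕ → K} (hs : ∀ p < k + 1 + j, Sum.elim v xs (posVar k j p) = s p) (y : K) :
    ∀ p < k + 1 + (j + 1), Sum.elim v (Fin.snoc xs y : Fin (j + 1) → K) (posVar k (j + 1) p) =
      Function.update s (k + 1 + j) y p := by
  intro p hp
  rcases Nat.lt_or_ge p (k + 1 + j) with h | h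
  · rw [Function.update_of_ne h.ne, ← hs p h]
    unfold posVar
    by_cases h₁ : p < k
    · simp [h₁]
    · by_cases h₂ : k < p
      · have h₃ : p - (k + 1) < j := by omega
        have h₄ : p - (k + 1) < j + 1 := by omega
        simp [h₁, h₂, h₃, h₄, Fin.snoc]
      · simp [h₁, h₂]
  · obtain rfl : p = k + 1 + j := by omega
    have h₁ : ¬ k + 1 + j < k := by omega
    have h₂ : k < k + 1 + j := by omega
    simp [posVar, h₁, h₂, Fin.snoc]

theorem realize_instances {K : Type*} [L.Structure K] (hB : ∀ b t, g b t ≤ B t) {k j : ℕ}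
    {v : Fin k ⊕ Fin 1 → K} {xs : Fin j → K} {s : ℕ → K}
    (hs : ∀ p < k + 1 + j, Sum.elim v xs (posVar k j p) = s p) :
    (instances C g B k j).Realize v xs ↔ Survives C g B 0 (k + 1 + j) s := by
  have h : ∀ t, B t < k + 1 + j →
      ((BoundedFormula.relabel (fun b => posVar k j (g b t)) C :
        L.BoundedFormula _ (j + 0)).Realize v xs ↔ C.Realize fun b => s (g b t)) := fun t ht => by
    rw [BoundedFormula.realize_relabel, Formula.Realize, iff_iff_eq]
    congr 1
    · funext b
      exact hs _ ((hB b t).trans_lt ht)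
    · exact Subsingleton.elim _ _
  simp only [instances, BoundedFormula.realize_not, BoundedFormula.realize_foldr_imp,
    BoundedFormula.realize_bot, List.mem_map, List.mem_range, Survives, imp_false, not_not,
    forall_exists_index, and_imp, forall_apply_eq_imp_iff₂]
  refine forall₂_congr fun t _ => ?_
  split_ifs with hB'
  · simp [hB', h t hB']
  · simp [hB', BoundedFormula.realize_not]

theorem realize_approx {K : Type*} [L.Structure K] (hB : ∀ b t, g b t ≤ B t) {k : ℕ}
    {v : Fin k ⊕ Fin 1 → K} (d j : ℕ) {xs : Fin j → K} {s : ℕ → K}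
    (hs : ∀ p < k + 1 + j, Sum.elim v xs (posVar k j p) = s p) :
    (approx C g B k d j).Realize v xs ↔ Survives C g B d (k + 1 + j) s := by
  induction d generalizing j s with
  | zero => exact realize_instances C g B hB hs
  | succ d ih =>
    rw [approx, Survives]
    split_ifs
    · rw [BoundedFormula.realize_all]
      exact forall_congr' fun y => ih (j + 1) (elim_posVar_snoc hs y)
    · rw [BoundedFormula.realize_ex]
      exact exists_congr fun y => ih (j + 1) (elim_posVar_snoc hs y)

/-- Survival for `d` rounds after position `k` has been played, as a formula. -/
theorem realize_approx_zero {K : Type*} [L.Structure K] (hB : ∀ b t, g b t ≤ B t) (k d : ℕ)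
    (s : ℕ → K) :
    Formula.Realize (approx C g B k d 0) (Sum.elim (fun i => s i) fun _ => s k) ↔
      Survives C g B d (k + 1) s := by
  refine realize_approx C g B hB d 0 fun p hp => ?_
  unfold posVar
  by_cases h₁ : p < k
  · simp [h₁]
  · obtain rfl : p = k := by omega
    simp

section Primrec

variable {C g B} [∀ n, Encodable (L.Functions n)] [∀ n, Encodable (L.Relations n)]

theorem primrec_encode_posVar {σ : Type*} [Primcodable σ] (k : ℕ) {m p : σ → ℕ} (hm : Primrec m)
    (hp : Primrec p) : Primrec fun s => encode (posVar k (m s) (p s)) := by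
  have h : ∀ s, encode (posVar k (m s) (p s)) = if p s < k then 2 * (2 * p s)
      else if k < p s ∧ p s - (k + 1) < m s then 2 * (p s - (k + 1)) + 1 else 2 := fun s => by
    unfold posVar
    split_ifs <;> rfl
  simp only [h]
  have hsub : Primrec fun s => p s - (k + 1) := Primrec.nat_sub.comp hp (Primrec.const _)
  have hdouble : ∀ {f : σ → ℕ}, Primrec f → Primrec fun s => 2 * f s := fun hf =>
    Primrec.nat_mul.comp (Primrec.const 2) hf
  exact Primrec.ite (Primrec.nat_lt.comp hp (Primrec.const k)) (hdouble (hdouble hp))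
    (Primrec.ite ((Primrec.nat_lt.comp (Primrec.const k) hp).and (Primrec.nat_lt.comp hsub hm))
      (Primrec.succ.comp (hdouble hsub)) (Primrec.const 2))

theorem codes_foldr_imp {α : Type*} [Encodable α] {n : ℕ} {ι : Type*} (l : List ι)
    (f : ι → L.BoundedFormula α n) :
    ((l.map f).foldr BoundedFormula.imp ⊥).codes =
      (l.flatMap fun i => 3 :: (f i).codes) ++
        (BoundedFormula.falsum : L.BoundedFormula α n).codes := by
  induction l with
  | nil => rfl
  | cons i l ih => simp [BoundedFormula.codes_imp, ih]

theorem primrec_codes_instances (hg : ∀ b, Primrec (g b)) (hB : Primrec B) (k : ℕ) :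
    Primrec fun m => (instances C g B k m).codes := by
  have hbot {σ : Type} [Primcodable σ] {m : σ → ℕ} (hm : Primrec m) :=
    BoundedFormula.primrec_codes_falsum (L := L) (Fin k ⊕ Fin 1) hm
  have hlen : Primrec fun m => k + 1 + m := Primrec.nat_add.comp (Primrec.const _) Primrec.id
  have hinst : Primrec₂ fun m t : ℕ => (if B t < k + 1 + m then
      (BoundedFormula.relabel (fun b => posVar k m (g b t)) C : L.BoundedFormula _ (m + 0))
      else BoundedFormula.not ⊥).codes := by
    have h : ∀ m t : ℕ, (if B t < k + 1 + m then
        (BoundedFormula.relabel (fun b => posVar k m (g b t)) C : L.BoundedFormula _ (m + 0))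
        else BoundedFormula.not ⊥).codes = if B t < k + 1 + m then
          (BoundedFormula.relabel (fun b => posVar k m (g b t)) C).codes else
          3 :: ((BoundedFormula.falsum : L.BoundedFormula (Fin k ⊕ Fin 1) m).codes ++
          (BoundedFormula.falsum : L.BoundedFormula (Fin k ⊕ Fin 1) m).codes) := fun m t => by
      split_ifs
      · rfl
      · exact BoundedFormula.codes_imp _ _
    simp only [h]
    exact Primrec.ite
      (Primrec.nat_lt.comp (hB.comp Primrec.snd) (hlen.comp Primrec.fst))
      (BoundedFormula.primrec_codes_relabel (σ := ℕ × ℕ) (α := Fin k ⊕ Fin 1) C Primrec.fst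
        (g := fun s b => posVar k s.1 (g b s.2))
        fun b => primrec_encode_posVar k Primrec.fst ((hg b).comp Primrec.snd))
      (Primrec.list_cons.comp (Primrec.const 3)
        (Primrec.list_append.comp (hbot Primrec.fst) (hbot Primrec.fst)))
  have h : ∀ m, (instances C g B k m).codes = 3 ::
      ((((List.range (k + 1 + m)).flatMap fun t => 3 :: (if B t < k + 1 + m then
        (BoundedFormula.relabel (fun b => posVar k m (g b t)) C : L.BoundedFormula _ (m + 0))
        else BoundedFormula.not ⊥).codes) ++
        (BoundedFormula.falsum : L.BoundedFormula (Fin k ⊕ Fin 1) m).codes) ++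
        (BoundedFormula.falsum : L.BoundedFormula (Fin k ⊕ Fin 1) m).codes) := fun m => by
    rw [← codes_foldr_imp, ← BoundedFormula.codes_imp]
    rfl
  simp only [h]
  exact Primrec.list_cons.comp (Primrec.const 3) (Primrec.list_append.comp
    (Primrec.list_append.comp (Primrec.list_flatMap (Primrec.list_range.comp hlen)
      (Primrec.list_cons.comp (Primrec.const 3) hinst)) (hbot Primrec.id)) (hbot Primrec.id))

/-- The effect of quantifying over position `k + 1 + j` on the sequence of symbol codes. -/
def quantifyCodes (k j : ℕ) (c : List ℕ) : List ℕ :=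
  if (k + 1 + j) % 2 = 0 then 7 :: c
  else 3 :: (7 :: 3 :: (c ++ [2 * (2 * (j + 1 + 2) + 1) + 1]) ++ [2 * (2 * (j + 2) + 1) + 1])

theorem codes_approx (k : ℕ) {d j m : ℕ} (hm : j + d = m) :
    (approx C g B k d j).codes = Nat.rec (motive := fun _ => List ℕ)
      (instances C g B k m).codes (fun i c => quantifyCodes k (m - (i + 1)) c) d := by
  induction d generalizing j with
  | zero => subst hm; rfl
  | succ d ih =>
    have h := ih (j := j + 1) (by omega)
    change _ = quantifyCodes k (m - (d + 1)) (Nat.rec _ _ d)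
    rw [← h, show m - (d + 1) = j by omega]
    simp only [quantifyCodes, approx, ← Nat.even_iff]
    split_ifs
    · rfl
    · simp only [BoundedFormula.ex, BoundedFormula.not, BoundedFormula.codes_imp,
        BoundedFormula.codes_all]
      simp only [Bot.bot, BoundedFormula.codes_falsum, List.cons_append]

theorem primrec_codes_approx (hg : ∀ b, Primrec (g b)) (hB : Primrec B) (k : ℕ) :
    Primrec fun m => (approx C g B k m 0).codes := by
  have hinst := primrec_codes_instances (C := C) hg hB k
  have hbot : ∀ {σ : Type} [Primcodable σ] {f : σ → ℕ}, Primrec f →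
      Primrec fun s => [2 * (2 * (f s + 2) + 1) + 1] := fun hf =>
    Primrec.list_cons.comp (Primrec.succ.comp (Primrec.nat_mul.comp (Primrec.const 2)
      (Primrec.succ.comp (Primrec.nat_mul.comp (Primrec.const 2)
        (Primrec.nat_add.comp hf (Primrec.const 2)))))) (Primrec.const [])
  have hstep : Primrec₂ fun (m : ℕ) (p : ℕ × List ℕ) => quantifyCodes k (m - (p.1 + 1)) p.2 := by
    have hj : Primrec fun q : ℕ × ℕ × List ℕ => q.1 - (q.2.1 + 1) :=
      Primrec.nat_sub.comp Primrec.fst (Primrec.succ.comp (Primrec.fst.comp Primrec.snd))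
    have hc : Primrec fun q : ℕ × ℕ × List ℕ => q.2.2 := Primrec.snd.comp Primrec.snd
    exact Primrec.ite
      (Primrec.eq.comp (Primrec.nat_mod.comp
        (Primrec.nat_add.comp (Primrec.const (k + 1)) hj) (Primrec.const 2)) (Primrec.const 0))
      (Primrec.list_cons.comp (Primrec.const 7) hc)
      (Primrec.list_cons.comp (Primrec.const 3) (Primrec.list_append.comp
        (Primrec.list_cons.comp (Primrec.const 7) (Primrec.list_cons.comp (Primrec.const 3)
          (Primrec.list_append.comp hc (hbot (Primrec.succ.comp hj))))) (hbot hj)))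
  exact (Primrec.nat_rec' Primrec.id hinst hstep).of_eq fun m =>
    (codes_approx k (Nat.zero_add m)).symm

theorem computable_approx (hg : ∀ b, Primrec (g b)) (hB : Primrec B) (k : ℕ) :
    Computable fun m => encode (BoundedFormula.listEncode (approx C g B k m 0)) := by
  simp only [encode_list_eq_encode_map (BoundedFormula.listEncode _)]
  exact (Primrec.encode.comp (primrec_codes_approx hg hB k)).to_comp

end Primrec

end Approximations

/-! ### Playing the game in a recursively saturated structure -/

theorem exists_sequence_of_step {K : Type*} {P : ℕ → (ℕ → K) → Prop} {Q : ℕ → K → Prop}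
    (hP : ∀ k s s', (∀ i < k, s i = s' i) → P k s → P k s') {k₀ : ℕ} {s₀ : ℕ → K} (h₀ : P k₀ s₀)
    (step : ∀ k, k₀ ≤ k → ∀ s, P k s → ∃ y, Q k y ∧ P (k + 1) (Function.update s k y)) :
    ∃ s : ℕ → K, (∀ i < k₀, s i = s₀ i) ∧ ∀ k, k₀ ≤ k → P k s ∧ Q k (s k) := by
  choose next hQ hnext using step
  let T : ∀ n, {s // P (k₀ + n) s} := fun n => Nat.rec ⟨s₀, h₀⟩
    (fun n s => ⟨Function.update s.1 (k₀ + n) (next _ (Nat.le_add_right _ _) s.1 s.2),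
      hnext _ _ _ _⟩) n
  have hT : ∀ n, (T (n + 1)).1 = Function.update (T n).1 (k₀ + n)
      (next _ (Nat.le_add_right _ _) (T n).1 (T n).2) := fun n => rfl
  have hstable : ∀ n m i, i < k₀ + n → (T (n + m)).1 i = (T n).1 i := by
    intro n m i hi
    induction m with
    | zero => rfl
    | succ m ih =>
      exact (congrFun (hT (n + m)) i).trans ((Function.update_of_ne (by omega) _ _).trans ih)
  have hlim : ∀ n i, i < k₀ + n → (T n).1 i = (T (i + 1 - k₀)).1 i := by
    intro n i hi
    rcases Nat.le_total n (i + 1 - k₀) with h | h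
    · obtain ⟨m, hm⟩ := Nat.exists_eq_add_of_le h
      rw [hm, hstable n m i hi]
    · obtain ⟨m, hm⟩ := Nat.exists_eq_add_of_le h
      rw [hm, hstable _ m i (by omega)]
  refine ⟨fun i => (T (i + 1 - k₀)).1 i, fun i hi => (hlim 0 i hi).symm, fun k hk => ?_⟩
  obtain ⟨n, rfl⟩ := Nat.exists_eq_add_of_le hk
  refine ⟨hP _ _ _ (hlim n) (T n).2, ?_⟩
  change Q (k₀ + n) ((T (k₀ + n + 1 - k₀)).1 (k₀ + n))
  rw [← hlim (n + 1) _ (by omega), hT, Function.update_self]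
  exact hQ _ _ _ _

section Game

variable {L : FirstOrder.Language.{u, u}} {β : Type*} {C : L.Formula β} {g : β → ℕ → ℕ}
  {B : ℕ → ℕ}

theorem Survives.of_succ {K : Type*} [L.Structure K] [Nonempty K] (hB : ∀ b t, g b t ≤ B t)
    {d k : ℕ} {s : ℕ → K} (h : Survives C g B (d + 1) k s) : Survives C g B d k s := by
  induction d generalizing k s with
  | zero =>
    have h' : ∃ y, Survives C g B 0 (k + 1) (Function.update s k y) := by
      rw [Survives] at h
      split_ifs at h
      · exact ⟨Classical.arbitrary K, h _⟩
      · exact h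
    obtain ⟨y, hy⟩ := h'
    intro t ht htB
    have := hy t (by omega) (by omega)
    refine (iff_of_eq (congrArg _ (funext fun b => ?_))).1 this
    exact Function.update_of_ne ((hB b t).trans_lt htB).ne _ _
  | succ d ih =>
    rw [Survives] at h ⊢
    split_ifs at h ⊢
    · exact fun y => ih (h y)
    · exact h.imp fun y hy => ih hy

theorem Survives.of_le {K : Type*} [L.Structure K] [Nonempty K] (hB : ∀ b t, g b t ≤ B t)
    {d d' k : ℕ} (hd : d ≤ d') {s : ℕ → K} (h : Survives C g B d' k s) : Survives C g B d k s := by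
  induction hd with
  | refl => exact h
  | step _ ih => exact ih (h.of_succ hB)

theorem Survives.congr {K : Type*} [L.Structure K] (hB : ∀ b t, g b t ≤ B t) {d k : ℕ}
    {s s' : ℕ → K} (hs : ∀ i < k, s i = s' i) (h : Survives C g B d k s) :
    Survives C g B d k s' := by
  induction d generalizing k s s' with
  | zero =>
    intro t ht htB
    refine (iff_of_eq (congrArg _ (funext fun b => ?_))).1 (h t ht htB)
    exact hs _ ((hB b t).trans_lt htB)
  | succ d ih =>
    have hupd : ∀ y, ∀ i < k + 1, Function.update s k y i = Function.update s' k y i := by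
      intro y i hi
      rcases eq_or_ne i k with rfl | hik
      · simp
      · simp [hik, hs i (by omega)]
    rw [Survives] at h ⊢
    split_ifs at h ⊢
    · exact fun y => ih (hupd y) (h y)
    · exact h.imp fun y hy => ih (hupd y) hy

/-- A winning strategy `σ` for player `∃` guarantees survival for any number of rounds. -/
theorem survives_of_strategy {K : Type*} [L.Structure K] {σ : ℕ → (ℕ → K) → K}
    {k₀ : ℕ} (hσ : ∀ k, k₀ ≤ k → ∀ s s', (∀ i < k, s i = s' i) → σ k s = σ k s') {s₀ : ℕ → K}
    (hC : ∀ (k : ℕ) (s : ℕ → K), (∀ i < k₀, s i = s₀ i) →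
      (∀ i < k, k₀ ≤ i → ¬ Even i → s i = σ i s) → ∀ t, B t < k → C.Realize fun b => s (g b t))
    (d : ℕ) {k : ℕ} (hk : k₀ ≤ k) {s : ℕ → K} (hs₀ : ∀ i < k₀, s i = s₀ i)
    (hs : ∀ i < k, k₀ ≤ i → ¬ Even i → s i = σ i s) : Survives C g B d k s := by
  induction d generalizing k s with
  | zero => exact fun t _ ht => hC k s hs₀ hs t ht
  | succ d ih =>
    have hmove : ∀ y, (¬ Even k → y = σ k s) →
        Survives C g B d (k + 1) (Function.update s k y) := by
      intro y hy
      have hupd : ∀ i ≤ k, k₀ ≤ i → σ i (Function.update s k y) = σ i s := fun i hi hi₀ =>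
        hσ _ hi₀ _ _ fun j hj => Function.update_of_ne (by omega) _ _
      refine ih (by omega) (fun i hi => ?_) fun i hi hi₀ hodd => ?_
      · rw [Function.update_of_ne (by omega), hs₀ i hi]
      · rw [hupd i (by omega) hi₀]
        rcases eq_or_ne i k with rfl | hik
        · rw [Function.update_self, hy hodd]
        · rw [Function.update_of_ne hik, hs i (by omega) hi₀ hodd]
    rw [Survives]
    split_ifs with hk'
    · exact fun y => hmove y fun h => absurd hk' h
    · exact ⟨σ k s, hmove _ fun _ => rfl⟩

theorem survives_iff_of_elementaryEmbedding {K K' : Type*} [L.Structure K] [L.Structure K']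
    (hB : ∀ b t, g b t ≤ B t) (f : K ↪ₑ[L] K') (d k : ℕ) (s : ℕ → K) :
    Survives C g B d (k + 1) (f ∘ s) ↔ Survives C g B d (k + 1) s := by
  rw [← realize_approx_zero C g B hB, ← realize_approx_zero C g B hB, ← f.map_formula]
  refine iff_of_eq (congrArg _ (funext fun x => ?_))
  rcases x with i | i <;> rfl

/-- In a recursively saturated structure, a play all of whose finite stages can be survived
extends to an infinite play in which all instances of `C` hold and player `∀` follows `e`. -/
theorem exists_play {M : Type u} [L.Structure M] [Nonempty M] [∀ n, Encodable (L.Functions n)]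
    [∀ n, Encodable (L.Relations n)] (h : IsRecursivelySaturated L M) (hg : ∀ b, Primrec (g b))
    (hBp : Primrec B) (hB : ∀ b t, g b t ≤ B t) {k₀ : ℕ} {s₀ : ℕ → M}
    (hs₀ : ∀ d, Survives C g B d k₀ s₀) (e : ℕ → M) :
    ∃ s : ℕ → M, (∀ i < k₀, s i = s₀ i) ∧ (∀ n, s (2 * (k₀ + n)) = e n) ∧
      ∀ t, C.Realize fun b => s (g b t) := by
  have hstep : ∀ k, k₀ ≤ k → ∀ s : ℕ → M, (∀ d, Survives C g B d k s) →
      ∃ y, (∀ n, k = 2 * (k₀ + n) → y = e n) ∧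
        ∀ d, Survives C g B d (k + 1) (Function.update s k y) := by
    intro k hk s hks
    by_cases hk' : Even k
    · refine ⟨e (k / 2 - k₀), fun n hn => by rw [hn]; congr; omega, fun d => ?_⟩
      have := hks (d + 1)
      rw [Survives, if_pos hk'] at this
      exact this _
    · have hreal : ∀ d y, Formula.Realize (approx C g B k d 0)
          (Sum.elim (fun i : Fin k => s i) fun _ => y) ↔
          Survives C g B d (k + 1) (Function.update s k y) := fun d y => by
        rw [← realize_approx_zero C g B hB]
        refine iff_of_eq (congrArg _ (funext fun x => ?_))
        rcases x with i | i
        · simp [ne_of_lt i.2]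
        · simp
      obtain ⟨y, hy⟩ := h k (fun d => approx C g B k d 0) (fun i => s i)
        (computable_approx hg hBp k) fun S => by
          have := hks (S.sup id + 1)
          rw [Survives, if_neg hk'] at this
          obtain ⟨y, hy⟩ := this
          exact ⟨y, fun d hd => (hreal d y).2 (hy.of_le hB (Finset.le_sup (f := id) hd))⟩
      refine ⟨y, fun n hn => absurd (hn ▸ even_two_mul _) hk', fun d => (hreal d y).1 (hy d)⟩
  obtain ⟨s, hs, hs'⟩ := exists_sequence_of_step
    (P := fun k (s : ℕ → M) => ∀ d, Survives C g B d k s)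
    (Q := fun k y => ∀ n, k = 2 * (k₀ + n) → y = e n)
    (fun k s s' hss' hk d => (hk d).congr hB hss') hs₀ hstep
  refine ⟨s, hs, fun n => (hs' _ (by omega)).2 n rfl, fun t => ?_⟩
  exact (hs' (k₀ + t + B t + 1) (by omega)).1 0 t (by omega) (by omega)

end Game

/-! ### Skolem normal form -/

section Skolem

variable {L : FirstOrder.Language.{u, u}} {M : Type u} {r : ℕ}

/-- Names of the auxiliary functions used to express a sentence with a relation variable `X`:
`none` is the characteristic function of `X`, `some (true, ψ)` that of the formula `ψ`, and
`some (false, ψ)` produces counterexamples to `ψ`. -/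
abbrev AuxFun (L : FirstOrder.Language.{u, u}) (M : Type u) (r : ℕ) : Type u :=
  Option (Bool × Σ m, ((L[[M]]).sum (relLang.{u} r)).BoundedFormula Empty m)

/-- Variables describing two points: parameters from `M`, and for each of the points its
coordinates and the values of the auxiliary functions there. -/
abbrev AuxVar (L : FirstOrder.Language.{u, u}) (M : Type u) (r : ℕ) : Type u :=
  M ⊕ (Bool × (ℕ ⊕ AuxFun L M r))

/-- A term evaluated at the first point. -/
def auxTerm {m : ℕ} : ((L[[M]]).sum (relLang.{u} r)).Term (Empty ⊕ Fin m) → L.Term (AuxVar L M r)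
  | .var (.inr i) => .var (.inr (false, .inl i))
  | .func (.inl (.inl f)) ts => .func f fun i => auxTerm (ts i)
  | @Term.func _ _ 0 (.inl (.inr a)) _ => .var (.inl a)
  | @Term.func _ _ 1 (.inl (.inr a)) _ => PEmpty.elim a
  | @Term.func _ _ (_ + 2) (.inl (.inr a)) _ => PEmpty.elim a
  | .func (.inr f) _ => PEmpty.elim f

/-- The value of the auxiliary function `j` at the point `b` is `c`, which stands for "true". -/
def auxTrue (c : M) (b : Bool) (j : AuxFun L M r) : L.Formula (AuxVar L M r) :=
  Term.equal (.var (.inr (b, .inr j))) (.var (.inl c))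

/-- The two points agree in their first `m` coordinates. -/
noncomputable def auxAgree (L : FirstOrder.Language.{u, u}) (M : Type u) (r m : ℕ) :
    L.Formula (AuxVar L M r) :=
  Formula.iInf fun i : Fin m =>
    Term.equal (.var (.inr (true, .inl i))) (.var (.inr (false, .inl i)))

/-- The conditions on the auxiliary functions that make `some (true, ψ)` the characteristic
function of `ψ`. -/
noncomputable def auxClause (c : M) : ∀ {m : ℕ},
    ((L[[M]]).sum (relLang.{u} r)).BoundedFormula Empty m → L.Formula (AuxVar L M r)
  | m, .falsum => (auxTrue c false (some (true, ⟨m, .falsum⟩))).not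
  | _, .equal t₁ t₂ => (auxTrue c false (some (true, ⟨_, .equal t₁ t₂⟩))).iff
      ((auxTerm t₁).equal (auxTerm t₂))
  | _, .rel (.inl (.inl R)) ts => (auxTrue c false (some (true, ⟨_, .rel (.inl (.inl R)) ts⟩))).iff
      (R.formula fun i => auxTerm (ts i))
  | _, .rel (.inl (.inr R)) _ => isEmptyElim R
  | _, @BoundedFormula.rel _ _ _ k (.inr R) ts =>
      (Formula.iInf fun i : Fin k => Term.equal (.var (.inr (true, .inl i))) (auxTerm (ts i))).imp
        ((auxTrue c false (some (true, ⟨_, .rel (.inr R) ts⟩))).iff (auxTrue c true none))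
  | _, .imp φ ψ => auxClause c φ ⊓ auxClause c ψ ⊓
      (auxTrue c false (some (true, ⟨_, .imp φ ψ⟩))).iff
        ((auxTrue c false (some (true, ⟨_, φ⟩))).imp (auxTrue c false (some (true, ⟨_, ψ⟩))))
  | m, .all φ => auxClause c φ ⊓
      (auxAgree L M r m).imp ((auxTrue c false (some (true, ⟨_, .all φ⟩))).imp
        (auxTrue c true (some (true, ⟨_, φ⟩)))) ⊓
      (auxAgree L M r m ⊓ Term.equal (.var (.inr (true, .inl m)))
          (.var (.inr (false, .inr (some (false, ⟨_, φ⟩)))))).imp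
        ((auxTrue c true (some (true, ⟨_, φ⟩))).imp
          (auxTrue c false (some (true, ⟨_, .all φ⟩))))

variable {K : Type*} [L.Structure K]

@[simp]
theorem realize_auxTrue {c : M} {b : Bool} {j : AuxFun L M r} {V : AuxVar L M r → K} :
    (auxTrue c b j).Realize V ↔ V (.inr (b, .inr j)) = V (.inl c) := by
  simp [auxTrue]

@[simp]
theorem realize_auxAgree {m : ℕ} {V : AuxVar L M r → K} :
    (auxAgree L M r m).Realize V ↔
      ∀ i : Fin m, V (.inr (true, .inl i)) = V (.inr (false, .inl i)) := by
  simp [auxAgree]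

variable [(constantsOn M).Structure K] [(relLang.{u} r).Structure K]

theorem realize_auxTerm {m : ℕ} (t : ((L[[M]]).sum (relLang.{u} r)).Term (Empty ⊕ Fin m))
    {V : AuxVar L M r → K}
    (hV : ∀ a, V (.inl a) = Structure.funMap (L := constantsOn M) (n := 0) a default)
    {v : Empty → K} :
    (auxTerm t).realize V = t.realize (Sum.elim v fun i : Fin m => V (.inr (false, .inl i))) := by
  induction t with
  | var x =>
    rcases x with x | i
    · exact x.elim
    · rfl
  | @func n f ts ih =>
    rcases f with (f | a) | f
    · simp only [auxTerm, Term.realize, ih]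
      rfl
    · match n, a with
      | 0, a =>
        simp only [auxTerm, Term.realize]
        rw [Subsingleton.elim (fun i => (ts i).realize _) default]
        exact hV a
      | 1, a => exact a.elim
      | _ + 2, a => exact a.elim
    · exact PEmpty.elim f

/-- The intended values of the auxiliary functions. -/
noncomputable def auxValue (c d : K) : AuxFun L M r → (ℕ → K) → K := by
  classical
  exact fun
  | none, x =>
    if Structure.RelMap (L := relLang.{u} r) (⟨⟨rfl⟩⟩ : (relLang.{u} r).Relations r)
      fun i : Fin r => x i then c else d
  | some (true, ⟨_, ψ⟩), x => if ψ.Realize default fun i : Fin _ => x i then c else d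
  | some (false, ⟨0, _⟩), _ => d
  | some (false, ⟨m + 1, ψ⟩), x =>
    if h : ∃ y, ¬ ψ.Realize default (Fin.snoc (fun i : Fin m => x i) y) then h.choose else d

/-- The valuation given by two points `x` and the values `y` of the auxiliary functions there. -/
def auxValuation (a : M → K) (x : Bool → ℕ → K) (y : Bool → AuxFun L M r → K) :
    AuxVar L M r → K :=
  Sum.elim a fun p => Sum.elim (x p.1) (y p.1) p.2

theorem auxValue_true {c d : K} (hcd : d ≠ c) {m : ℕ}
    {ψ : ((L[[M]]).sum (relLang.{u} r)).BoundedFormula Empty m} {x : ℕ → K} :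
    auxValue c d (some (true, ⟨m, ψ⟩)) x = c ↔ ψ.Realize default fun i : Fin _ => x i := by
  simp [auxValue, hcd]

theorem auxValue_none {c d : K} (hcd : d ≠ c) {x : ℕ → K} :
    auxValue (L := L) (M := M) (r := r) c d none x = c ↔
      Structure.RelMap (L := relLang.{u} r) (⟨⟨rfl⟩⟩ : (relLang.{u} r).Relations r)
        fun i : Fin r => x i := by
  simp [auxValue, hcd]

theorem auxValue_false {c d : K} {m : ℕ}
    {ψ : ((L[[M]]).sum (relLang.{u} r)).BoundedFormula Empty (m + 1)} {x : ℕ → K}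
    (h : ψ.Realize default
      (Fin.snoc (fun i : Fin m => x i) (auxValue c d (some (false, ⟨_, ψ⟩)) x))) :
    ψ.all.Realize default fun i : Fin _ => x i := by
  rw [BoundedFormula.realize_all]
  by_contra hne
  rw [not_forall] at hne
  refine hne.choose_spec ?_
  simpa only [auxValue, hne, ↓reduceDIte] using h

theorem snoc_eq_of_agree {m : ℕ} {x x' : ℕ → K} (h : ∀ i : Fin m, x' i = x i) :
    (fun i : Fin (m + 1) => x' i) = Fin.snoc (fun i : Fin m => x i) (x' m) := by
  funext i
  refine Fin.lastCases ?_ (fun i => ?_) i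
  · simp
  · simp [h]

/-- The intended auxiliary functions satisfy all conditions. -/
theorem realize_auxClause_auxValue {c : M} {a : M → K}
    (ha : ∀ b, a b = Structure.funMap (L := constantsOn M) (n := 0) b default) {d : K}
    (hd : d ≠ a c) {m : ℕ} (ψ : ((L[[M]]).sum (relLang.{u} r)).BoundedFormula Empty m)
    (x : Bool → ℕ → K) :
    (auxClause c ψ).Realize (auxValuation a x fun b j => auxValue (a c) d j (x b)) := by
  have hterm : ∀ {m : ℕ} (t : ((L[[M]]).sum (relLang.{u} r)).Term (Empty ⊕ Fin m)),
      (auxTerm t).realize (auxValuation a x fun b j => auxValue (a c) d j (x b)) =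
        t.realize (Sum.elim default fun i : Fin _ => x false i) := fun t =>
    realize_auxTerm t ha (v := default)
  have htrue : ∀ {m : ℕ} (b : Bool)
      (ψ : ((L[[M]]).sum (relLang.{u} r)).BoundedFormula Empty m),
      (auxTrue c b (some (true, ⟨m, ψ⟩))).Realize
        (auxValuation a x fun b j => auxValue (a c) d j (x b)) ↔
        ψ.Realize default fun i : Fin _ => x b i := fun b ψ =>
    realize_auxTrue.trans (auxValue_true hd)
  have hagree : ∀ {m : ℕ}, (auxAgree L M r m).Realize
      (auxValuation a x fun b j => auxValue (a c) d j (x b)) ↔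
      ∀ i : Fin m, x true i = x false i := realize_auxAgree
  induction ψ with
  | falsum => exact mt (htrue false .falsum).1 id
  | equal t₁ t₂ =>
    rw [auxClause, Formula.realize_iff, htrue, Formula.realize_equal, hterm, hterm]
    exact Iff.rfl
  | @rel m l R ts =>
    rcases R with (R | R) | R
    · rw [auxClause, Formula.realize_iff, htrue, Formula.realize_rel]
      simp only [hterm]
      exact Iff.rfl
    · exact isEmptyElim R
    · obtain ⟨⟨rfl⟩⟩ := R
      refine Formula.realize_imp.2 fun h => ?_
      rw [Formula.realize_iInf] at h
      rw [Formula.realize_iff, htrue, realize_auxTrue]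
      have h' : (fun i : Fin l => x true i) =
          fun i => (ts i).realize (Sum.elim default fun i : Fin _ => x false i) := by
        funext i
        have := h i
        rw [Formula.realize_equal, hterm] at this
        exact this
      refine Iff.trans ?_ (auxValue_none (L := L) (M := M) hd).symm
      rw [h']
      exact Iff.rfl
  | imp φ ψ ih₁ ih₂ =>
    rw [auxClause, Formula.realize_inf, Formula.realize_inf, Formula.realize_iff,
      Formula.realize_imp, htrue, htrue, htrue]
    exact ⟨⟨ih₁, ih₂⟩, Iff.rfl⟩
  | @all m φ ih =>
    simp only [auxClause, Formula.realize_inf, Formula.realize_imp, htrue, hagree]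
    refine ⟨⟨ih, fun h hall => ?_⟩, fun h hφ => ?_⟩
    · rw [snoc_eq_of_agree h]
      exact BoundedFormula.realize_all.1 hall _
    · have hy := h.2
      rw [Formula.realize_equal] at hy
      replace hy : x true m = auxValue (a c) d (some (false, ⟨_, φ⟩)) (x false) := hy
      rw [snoc_eq_of_agree h.1, hy] at hφ
      exact auxValue_false hφ

theorem exists_point_snoc {pt : ℕ → ℕ → K}
    (hpt : ∀ n (z : Fin n → K), ∃ t, ∀ i : Fin n, pt t i = z i)
    (t m : ℕ) (y : K) : ∃ t', (∀ i : Fin m, pt t' i = pt t i) ∧ pt t' m = y := by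
  obtain ⟨t', ht'⟩ := hpt (m + 1) (Fin.snoc (fun i : Fin m => pt t i) y)
  refine ⟨t', fun i => ?_, ?_⟩
  · simpa using ht' i.castSucc
  · simpa using ht' (Fin.last m)

/-- If points `pt t` realizing all finite tuples, together with values `val t` of the auxiliary
functions there, satisfy all conditions, then `some (true, ψ)` is the characteristic function of
`ψ`, where `X` is interpreted using `none`. -/
theorem auxTrue_iff_realize {c : M} {a : M → K}
    (ha : ∀ b, a b = Structure.funMap (L := constantsOn M) (n := 0) b default)
    {pt : ℕ → ℕ → K} {val : ℕ → AuxFun L M r → K}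
    (hpt : ∀ n (z : Fin n → K), ∃ t, ∀ i : Fin n, pt t i = z i)
    (hX : ∀ z : Fin r → K,
      Structure.RelMap (L := relLang.{u} r) (⟨⟨rfl⟩⟩ : (relLang.{u} r).Relations r) z ↔
        ∃ t, (∀ i : Fin r, pt t i = z i) ∧ val t none = a c)
    {m : ℕ} {ψ : ((L[[M]]).sum (relLang.{u} r)).BoundedFormula Empty m}
    (hψ : ∀ t t', (auxClause c ψ).Realize
      (auxValuation a (fun b => pt (bif b then t' else t)) fun b => val (bif b then t' else t)))
    (t : ℕ) : val t (some (true, ⟨m, ψ⟩)) = a c ↔ ψ.Realize default fun i : Fin m => pt t i := by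
  have hterm : ∀ {m : ℕ} (t t' : ℕ) (τ : ((L[[M]]).sum (relLang.{u} r)).Term (Empty ⊕ Fin m)),
      (auxTerm τ).realize (auxValuation a (fun b => pt (bif b then t' else t))
        fun b => val (bif b then t' else t)) =
        τ.realize (Sum.elim default fun i : Fin _ => pt t i) := fun t t' τ =>
    realize_auxTerm τ ha (v := default)
  have htrue : ∀ (t t' : ℕ) (b : Bool) (j : AuxFun L M r), (auxTrue c b j).Realize
      (auxValuation a (fun b => pt (bif b then t' else t)) fun b => val (bif b then t' else t)) ↔
        val (bif b then t' else t) j = a c := fun t t' b j => realize_auxTrue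
  have hagree : ∀ (t t' : ℕ) {m : ℕ}, (auxAgree L M r m).Realize
      (auxValuation a (fun b => pt (bif b then t' else t)) fun b => val (bif b then t' else t)) ↔
      ∀ i : Fin m, pt t' i = pt t i := fun t t' {m} => realize_auxAgree
  induction ψ generalizing t with
  | falsum => exact iff_of_false (mt (htrue t t false _).2 (hψ t t)) id
  | equal t₁ t₂ =>
    have h := hψ t t
    rw [auxClause, Formula.realize_iff, htrue, Formula.realize_equal, hterm, hterm] at h
    exact h
  | @rel m l R ts =>
    rcases R with (R | R) | R
    · have h := hψ t t
      rw [auxClause, Formula.realize_iff, htrue, Formula.realize_rel] at h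
      simp only [hterm] at h
      exact h
    · exact isEmptyElim R
    · obtain ⟨⟨rfl⟩⟩ := R
      have h : ∀ t', (∀ i : Fin l, pt t' i = (ts i).realize
          (Sum.elim default fun i : Fin _ => pt t i)) →
          (val t (some (true, ⟨m, .rel (.inr ⟨⟨rfl⟩⟩) ts⟩)) = a c ↔ val t' none = a c) := by
        intro t' ht'
        have h := Formula.realize_imp.1 (hψ t t')
        rw [Formula.realize_iInf, Formula.realize_iff, htrue, htrue] at h
        refine h fun i => ?_
        rw [Formula.realize_equal, hterm]
        exact ht' i
      refine Iff.trans ?_ (hX fun i => (ts i).realize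
        (Sum.elim default fun i : Fin _ => pt t i)).symm
      constructor
      · intro hval
        obtain ⟨t', ht'⟩ := hpt l fun i => (ts i).realize
          (Sum.elim default fun i : Fin _ => pt t i)
        exact ⟨t', ht', (h t' ht').1 hval⟩
      · rintro ⟨t', ht', hval⟩
        exact (h t' ht').2 hval
  | imp φ ψ ih₁ ih₂ =>
    simp only [auxClause, Formula.realize_inf] at hψ
    have h := (hψ t t).2
    rw [Formula.realize_iff, Formula.realize_imp, htrue, htrue, htrue] at h
    exact h.trans (imp_congr (ih₁ (fun t t' => (hψ t t').1.1) t)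
      (ih₂ (fun t t' => (hψ t t').1.2) t))
  | @all m φ ih =>
    simp only [auxClause, Formula.realize_inf, Formula.realize_imp, htrue, hagree,
      Formula.realize_equal] at hψ
    have ih' := ih fun t t' => (hψ t t').1.1
    rw [BoundedFormula.realize_all]
    constructor
    · intro hval y
      obtain ⟨t', ht', hy⟩ := exists_point_snoc hpt t m y
      have h := (ih' t').1 ((hψ t t').1.2 ht' hval)
      rwa [snoc_eq_of_agree ht', hy] at h
    · intro hall
      obtain ⟨t', ht', hy⟩ := exists_point_snoc hpt t m (val t (some (false, ⟨_, φ⟩)))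
      refine (hψ t t').2 ⟨ht', hy⟩ ((ih' t').2 ?_)
      rw [snoc_eq_of_agree ht']
      exact hall _

end Skolem

/-! ### Coding tuples by natural numbers -/

/-- The `i`-th coordinate of the tuple coded by `t`. -/
def coord : ℕ → ℕ → ℕ
  | 0, t => t.unpair.1
  | i + 1, t => coord i t.unpair.2

theorem coord_le (i t : ℕ) : coord i t ≤ t := by
  induction i generalizing t with
  | zero => exact Nat.unpair_left_le t
  | succ i ih => exact (ih _).trans (Nat.unpair_right_le t)

theorem coord_unpair_half_sub_lt {k k₀ : ℕ} (h₀ : 0 < k₀) (hk : k₀ ≤ k) (i : ℕ) :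
    coord i (k / 2 - k₀).unpair.2 < k := by
  have := (coord_le i _).trans (Nat.unpair_right_le (k / 2 - k₀))
  omega

theorem primrec_coord (i : ℕ) : Primrec (coord i) := by
  induction i with
  | zero => exact Primrec.fst.comp Primrec.unpair
  | succ i ih => exact ih.comp (Primrec.snd.comp Primrec.unpair)

theorem exists_coord_eq (n : ℕ) (z : Fin n → ℕ) : ∃ t, ∀ i : Fin n, coord i t = z i := by
  induction n with
  | zero => exact ⟨0, fun i => i.elim0⟩
  | succ n ih =>
    obtain ⟨t, ht⟩ := ih (Fin.tail z)
    refine ⟨Nat.pair (z 0) t, Fin.cases ?_ fun i => ?_⟩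
    · simp [coord]
    · simpa [coord, Fin.tail] using ht i

theorem primrec_finset_sum {ι : Type*} (S : Finset ι) {g : ι → ℕ → ℕ} (hg : ∀ i, Primrec (g i)) :
    Primrec fun t => ∑ i ∈ S, g i t := by
  classical
  induction S using Finset.induction_on with
  | empty => simpa using Primrec.const 0
  | insert i S hi ih => simpa [Finset.sum_insert hi] using Primrec.nat_add.comp (hg i) ih

/-! ### Resplendence -/

section Resplendence

variable {L : FirstOrder.Language.{u, u}} {M : Type u} {r : ℕ}

/-- The position in the game at which the value of an auxiliary variable is played, for the two
points coded by `t`. Even positions from `2 * k₀` on enumerate the structure. -/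
def auxPos (idx : M → ℕ) (num : AuxFun L M r → ℕ) (k₀ t : ℕ) : AuxVar L M r → ℕ
  | .inl a => idx a
  | .inr (b, .inl i) => coord i (bif b then t.unpair.2 else t.unpair.1)
  | .inr (b, .inr j) => 2 * (k₀ + Nat.pair (num j) (bif b then t.unpair.2 else t.unpair.1)) + 1

theorem primrec_auxPos (idx : M → ℕ) (num : AuxFun L M r → ℕ) (k₀ : ℕ) (x : AuxVar L M r) :
    Primrec fun t => auxPos idx num k₀ t x := by
  have hsel : ∀ b : Bool, Primrec fun t : ℕ => bif b then t.unpair.2 else t.unpair.1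
    | true => Primrec.snd.comp Primrec.unpair
    | false => Primrec.fst.comp Primrec.unpair
  rcases x with a | ⟨b, i | j⟩
  · exact Primrec.const _
  · exact (primrec_coord i).comp (hsel b)
  · exact Primrec.succ.comp (Primrec.nat_mul.comp (Primrec.const 2) (Primrec.nat_add.comp
      (Primrec.const k₀) (Primrec₂.natPair.comp (Primrec.const _) (hsel b))))

variable [L.Structure M]

theorem exists_eq_sumStructure {L₁ L₂ : Language} {K : Type*}
    (S : (L₁.sum L₂).Structure K) :
    ∃ (S₁ : L₁.Structure K) (S₂ : L₂.Structure K), S = @Language.sumStructure L₁ L₂ K S₁ S₂ := by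
  refine ⟨(LHom.sumInl : L₁ →ᴸ L₁.sum L₂).reduct K, (LHom.sumInr : L₂ →ᴸ L₁.sum L₂).reduct K, ?_⟩
  ext n (f | f) xs <;> rfl

theorem realize_zero_iff {L' : Language.{u, u}} {K : Type u} [L'.Structure K] {Φ : L'.Sentence}
    {xs : Fin 0 → K} : BoundedFormula.Realize Φ default xs ↔ Sentence.Realize K Φ := by
  rw [Subsingleton.elim xs default]
  rfl

/-- A sentence consistent with the elementary diagram of `M` holds in an elementary extension. -/
theorem exists_elementaryEmbedding_of_isSatisfiable
    {Φ : ((L[[M]]).sum (relLang.{u} r)).Sentence}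
    (h : Theory.IsSatisfiable
      ((LHom.sumInl : L[[M]] →ᴸ (L[[M]]).sum (relLang.{u} r)).onTheory (L.elementaryDiagram M)
        ∪ {Φ})) :
    ∃ (K : Type u) (_ : L.Structure K) (_ : (constantsOn M).Structure K)
      (_ : (relLang.{u} r).Structure K) (f : M ↪ₑ[L] K),
      (∀ a, f a = Structure.funMap (L := constantsOn M) (n := 0) a default) ∧
        Sentence.Realize K Φ := by
  obtain ⟨@⟨K, S, hmodel, _⟩⟩ := h
  obtain ⟨S₁, S₂, rfl⟩ := exists_eq_sumStructure S
  obtain ⟨S₃, S₄, rfl⟩ := exists_eq_sumStructure (L₁ := L) (L₂ := constantsOn M) S₁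
  have hdiag : K ⊨ L.elementaryDiagram M :=
    (@LHom.onTheory_model _ _ K _ _ (LHom.sumInl : L[[M]] →ᴸ (L[[M]]).sum (relLang.{u} r))
      ⟨fun _ _ => rfl, fun _ _ => rfl⟩ _).1 (hmodel.mono Set.subset_union_left)
  exact ⟨K, S₃, S₄, S₂, ElementaryEmbedding.ofModelsElementaryDiagram L M K, fun a => rfl,
    hmodel.realize_of_mem Φ (Set.mem_union_right _ rfl)⟩

theorem exists_relStructure_of_nontrivial [Nontrivial M] [Countable M]
    [∀ n, Encodable (L.Functions n)] [∀ n, Encodable (L.Relations n)]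
    (h : IsRecursivelySaturated L M) {Φ : ((L[[M]]).sum (relLang.{u} r)).Sentence}
    {K : Type u} [L.Structure K] [(constantsOn M).Structure K] [(relLang.{u} r).Structure K]
    (f : M ↪ₑ[L] K) (hf : ∀ a, f a = Structure.funMap (L := constantsOn M) (n := 0) a default)
    (hΦ : Sentence.Realize K Φ) :
    ∃ _ : (relLang.{u} r).Structure M, Sentence.Realize M Φ := by
  classical
  obtain ⟨c', c, hc⟩ := exists_pair_ne M
  obtain ⟨e, he⟩ := exists_surjective_nat M
  let idx : M → ℕ := Function.surjInv he
  have hidx : ∀ a, e (idx a) = a := Function.surjInv_eq he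
  let C₀ : L.Formula (AuxVar L M r) := auxClause c Φ ⊓ auxTrue c false (some (true, ⟨0, Φ⟩))
  let fv := C₀.freeVarFinset
  let J : Finset (AuxFun L M r) :=
    fv.image (Sum.elim (fun _ => none) fun p => Sum.elim (fun _ => none) id p.2)
  have hJ : ∀ b j, (.inr (b, .inr j) : AuxVar L M r) ∈ fv → j ∈ J := fun b j hj =>
    Finset.mem_image.2 ⟨_, hj, rfl⟩
  obtain ⟨num, hnum⟩ := Set.countable_iff_exists_injOn.1 (J : Set (AuxFun L M r)).toFinite.countable
  let jOf : ℕ → AuxFun L M r := Function.invFunOn num J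
  have hjOf : ∀ j ∈ J, jOf (num j) = j := fun j hj => hnum.leftInvOn_invFunOn hj
  let k₁ := fv.sup (Sum.elim idx fun _ => 0)
  let k₀ := k₁ + 1
  have hk₀ : ∀ a, (.inl a : AuxVar L M r) ∈ fv → idx a < k₀ := fun a ha =>
    Nat.lt_succ_of_le (Finset.le_sup (f := Sum.elim idx fun _ => 0) ha)
  let g : fv → ℕ → ℕ := fun x t => auxPos idx num k₀ t x
  let B : ℕ → ℕ := fun t => ∑ x : fv, g x t
  have hB : ∀ x t, g x t ≤ B t := fun x t =>
    Finset.single_le_sum (f := fun x => g x t) (fun _ _ => Nat.zero_le _) (Finset.mem_univ x)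
  have hg : ∀ x, Primrec (g x) := fun x => primrec_auxPos idx num k₀ x
  let C : L.Formula fv := C₀.restrictFreeVar id
  have hC : ∀ {N : Type u} [L.Structure N] (s : ℕ → N) (t : ℕ) (V : AuxVar L M r → N),
      (∀ x : fv, s (g x t) = V x) → ((C.Realize fun x => s (g x t)) ↔ C₀.Realize V) :=
    fun s t V hV => BoundedFormula.realize_restrictFreeVar V hV
  let σ : ℕ → (ℕ → K) → K := fun k s => auxValue (f c) (f c') (jOf (k / 2 - k₀).unpair.1)
    fun i => s (coord i (k / 2 - k₀).unpair.2)
  have hσ : ∀ k, k₀ ≤ k → ∀ s s' : ℕ → K, (∀ i < k, s i = s' i) → σ k s = σ k s' := by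
    intro k hk s s' hs
    exact congrArg (auxValue _ _ _) (funext fun i =>
      hs _ (coord_unpair_half_sub_lt (Nat.succ_pos k₁) hk i))
  have hsurv : ∀ d, Survives C g B d k₀ (f ∘ e) := fun d => by
    refine survives_of_strategy (s₀ := f ∘ e) hσ (fun k s hs₀ hs t ht => ?_) d le_rfl
      (fun _ _ => rfl) fun i hi hi' => absurd hi' (Nat.not_le.2 hi)
    let x : Bool → ℕ → K := fun b i => s (coord i (bif b then t.unpair.2 else t.unpair.1))
    refine (hC s t (auxValuation f x fun b j => auxValue (f c) (f c') j (x b)) ?_).2 ?_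
    · rintro ⟨a | ⟨b, i | j⟩, hx⟩
      · exact (hs₀ _ (hk₀ a hx)).trans (congrArg f (hidx a))
      · rfl
      · have hlt := (hB ⟨_, hx⟩ t).trans_lt ht
        have hpos : g ⟨.inr (b, .inr j), hx⟩ t =
            2 * (k₀ + Nat.pair (num j) (bif b then t.unpair.2 else t.unpair.1)) + 1 := rfl
        rw [hpos] at hlt ⊢
        rw [hs _ hlt (by omega) (by simp)]
        have hdiv : (2 * (k₀ + Nat.pair (num j) (bif b then t.unpair.2 else t.unpair.1)) + 1) / 2 -
            k₀ = Nat.pair (num j) (bif b then t.unpair.2 else t.unpair.1) := by omega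
        simp only [σ, hdiv, Nat.unpair_pair, hjOf j (hJ b j hx)]
        rfl
    · have hne : f c' ≠ f c := f.injective.ne hc
      refine Formula.realize_inf.2 ⟨realize_auxClause_auxValue hf hne Φ x, ?_⟩
      refine realize_auxTrue.2 ((auxValue_true hne).2 ?_)
      exact realize_zero_iff.2 hΦ
  obtain ⟨s, hs₀, hsurj, hs⟩ := exists_play h hg (primrec_finset_sum _ hg) hB (k₀ := k₀) (s₀ := e)
    (fun d => (survives_iff_of_elementaryEmbedding hB f d k₁ e).1 (hsurv d)) e
  let pt : ℕ → ℕ → M := fun t i => s (coord i t)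
  let val : ℕ → AuxFun L M r → M := fun t j => s (2 * (k₀ + Nat.pair (num j) t) + 1)
  have hpt : ∀ n (z : Fin n → M), ∃ t, ∀ i : Fin n, pt t i = z i := fun n z => by
    obtain ⟨t, ht⟩ := exists_coord_eq n fun i => 2 * (k₀ + idx (z i))
    exact ⟨t, fun i => by simp only [pt, ht, hsurj, hidx]⟩
  have hreal : ∀ t t', C₀.Realize (auxValuation id (fun b => pt (bif b then t' else t))
      fun b => val (bif b then t' else t)) := by
    intro t t'
    refine (hC s (Nat.pair t t') _ ?_).1 (hs _)
    rintro ⟨a | ⟨b, i | j⟩, hx⟩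
    · exact (hs₀ _ (hk₀ a hx)).trans (hidx a)
    · simp [g, auxPos, auxValuation, pt]
    · simp [g, auxPos, auxValuation, val]
  let S : (relLang.{u} r).Structure M :=
    { funMap := fun j => PEmpty.elim j
      RelMap := fun {n} _ z => ∃ t, (∀ i : Fin n, pt t i = z i) ∧ val t none = c }
  refine ⟨S, ?_⟩
  have htruth := auxTrue_iff_realize (a := id) (c := c) (ψ := Φ) (fun _ => rfl) hpt
    (fun z => Iff.rfl) (fun t t' => (Formula.realize_inf.1 (hreal t t')).1) 0
  exact realize_zero_iff.1 (htruth.1 (realize_auxTrue.1 (Formula.realize_inf.1 (hreal 0 0)).2))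

theorem exists_relStructure_of_subsingleton [Subsingleton M] [Nonempty M]
    {Φ : ((L[[M]]).sum (relLang.{u} r)).Sentence}
    {K : Type u} [L.Structure K] [(constantsOn M).Structure K] [(relLang.{u} r).Structure K]
    (f : M ↪ₑ[L] K) (hΦ : Sentence.Realize K Φ) :
    ∃ _ : (relLang.{u} r).Structure M, Sentence.Realize M Φ := by
  have hK : Subsingleton K := by
    have h := (f.map_sentence (Sentence.cardGe L 2)).symm
    rw [Sentence.realize_cardGe, Sentence.realize_cardGe, Nat.cast_ofNat, Cardinal.two_le_iff,
      Cardinal.two_le_iff, ← nontrivial_iff, ← nontrivial_iff] at h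
    exact not_nontrivial_iff_subsingleton.1 fun hN => not_nontrivial M (h.1 hN)
  let S : (relLang.{u} r).Structure M :=
    { funMap := fun j => PEmpty.elim j
      RelMap := fun R z => Structure.RelMap R (f ∘ z) }
  have hbij : Function.Bijective f := ⟨f.injective, fun y =>
    ⟨Classical.arbitrary M, Subsingleton.elim _ _⟩⟩
  let F : M ≃[(L[[M]]).sum (relLang.{u} r)] K :=
    { toEquiv := Equiv.ofBijective f hbij
      map_fun' := fun _ _ => Subsingleton.elim _ _
      map_rel' := by
        rintro n ((R | R) | R) z
        · exact f.map_rel R z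
        · exact isEmptyElim R
        · exact Iff.rfl }
  exact ⟨S, (StrongHomClass.realize_sentence F Φ).2 hΦ⟩

end Resplendence

end FirstOrder.Language

theorem countable_recursively_saturated_implies_resplendent
    (L : FirstOrder.Language.{u, u}) [∀ n, Encodable (L.Functions n)]
    [∀ n, Encodable (L.Relations n)] (M : Type u) [L.Structure M] [Nonempty M] [Countable M]
    (h : IsRecursivelySaturated L M) : IsResplendent L M := by
  intro r Φ hΦ
  obtain ⟨K, _, _, _, f, hf, hK⟩ := exists_elementaryEmbedding_of_isSatisfiable hΦ
  rcases subsingleton_or_nontrivial M with _ | _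
  · exact exists_relStructure_of_subsingleton f hK
  · exact exists_relStructure_of_nontrivial h f hf hK
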